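/- arXiv:2203.08645 — 7 statements merged into one kernel-verified Lean document; each statement's English description precedes it below -/
import Mathlib

section
/- Let f : 2^{[k]} → ℝ be normalized and increasing. Then for every u ∈ ℝ^k and every y ∈ {−1,1}^k, L^f(⌊u⌉, y) ≤ L^f(u, y), where ⌊u⌉ is the clipping of u to [−1,1]^k. -/
open Finset

noncomputable section

/-- The set {π(1),…,π(i)} of the first `i` elements under permutation `π`. -/
def Spi (k : ℕ) (π : Equiv.Perm (Fin k)) (i : ℕ) : Finset (Fin k) :=
  (Finset.univ.filter (fun m : Fin k => (m : ℕ) < i)).image π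

/-- The Lovász extension of a set function `f`. -/
def lovaszExt (k : ℕ) (f : Finset (Fin k) → ℝ) (x : Fin k → ℝ) : ℝ :=
  Finset.univ.sup' Finset.univ_nonempty
    (fun π : Equiv.Perm (Fin k) =>
      ∑ i : Fin k, x (π i) * (f (Spi k π ((i : ℕ) + 1)) - f (Spi k π (i : ℕ))))

/-- The Lovász hinge `L^f(u,y) = F((𝟙 - u ⊙ y)₊)`. -/
def lovaszHinge (k : ℕ) (f : Finset (Fin k) → ℝ) (u y : Fin k → ℝ) : ℝ :=
  lovaszExt k f (fun i => max (1 - u i * y i) 0)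

/-- Componentwise clipping of `u` to `[-1,1]^k`. -/
def clip {k : ℕ} (u : Fin k → ℝ) : Fin k → ℝ := fun i => Real.sign (u i) * min |u i| 1

lemma Spi_mono (k : ℕ) (π : Equiv.Perm (Fin k)) : Monotone (Spi k π) := fun _ _ hij =>
  Finset.image_subset_image
    (Finset.monotone_filter_right _ fun _ _ hm => lt_of_lt_of_le hm hij)

lemma monotone_of_disjoint_union {k : ℕ} {f : Finset (Fin k) → ℝ}
    (hinc : ∀ S T : Finset (Fin k), Disjoint S T → f S ≤ f (S ∪ T)) : Monotone f := by
  intro S T hST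
  simpa [Finset.union_sdiff_of_subset hST] using hinc S (T \ S) Finset.disjoint_sdiff

/-- The Lovász extension of an increasing set function is increasing. -/
lemma lovaszExt_mono {k : ℕ} {f : Finset (Fin k) → ℝ} (hf : Monotone f) :
    Monotone (lovaszExt k f) := by
  intro x x' hx
  refine Finset.sup'_mono_fun fun π _ => Finset.sum_le_sum fun i _ => ?_
  exact mul_le_mul_of_nonneg_right (hx (π i))
    (sub_nonneg.2 (hf (Spi_mono k π (Nat.le_succ _))))

/-- Clipping decreases the hinge loss of each component. -/
lemma hinge_clip_le {k : ℕ} (u y : Fin k → ℝ) (i : Fin k) (hy : y i = -1 ∨ y i = 1) :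
    max (1 - clip u i * y i) 0 ≤ max (1 - u i * y i) 0 := by
  unfold clip
  rcases lt_trichotomy (u i) 0 with hu | hu | hu
  · rw [Real.sign_of_neg hu, abs_of_neg hu]
    rcases hy with hy | hy <;> rw [hy] <;> grind
  · simp [hu]
  · rw [Real.sign_of_pos hu, abs_of_pos hu]
    rcases hy with hy | hy <;> rw [hy] <;> grind

/-- clipping to `[-1,1]^k` can only decrease the Lovász hinge. -/
theorem stmt1 (k : ℕ) (hk : 1 ≤ k) (f : Finset (Fin k) → ℝ) (hnorm : f ∅ = 0)
    (hinc : ∀ S T : Finset (Fin k), Disjoint S T → f S ≤ f (S ∪ T))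
    (u y : Fin k → ℝ) (hy : ∀ i, y i = -1 ∨ y i = 1) :
    lovaszHinge k f (clip u) y ≤ lovaszHinge k f u y := by
  exact lovaszExt_mono (monotone_of_disjoint_union hinc) fun i => hinge_clip_le u y i (hy i)
end
end

section
/- Let f : 2^{[k]} → ℝ be submodular, increasing, and normalized. Then for every permutation π of [k] and all y, y' ∈ {−1,1}^k, the function u ↦ L^f(u, y') is affine on P_{π,y}; that is, there exist w ∈ ℝ^k and b ∈ ℝ such that L^f(u, y') = ⟨w, u⟩ + b for all u ∈ P_{π,y}. -/
open Finset

noncomputable section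

/-- The indicator vector `𝟙_{π,i}` of `{π(1),…,π(i)}`. -/
def onespi (k : ℕ) (π : Equiv.Perm (Fin k)) (i : ℕ) : Fin k → ℝ :=
  fun j => if j ∈ Spi k π i then 1 else 0

theorem mem_Spi {k : ℕ} (π : Equiv.Perm (Fin k)) (i : ℕ) (j : Fin k) :
    j ∈ Spi k π i ↔ (π.symm j : ℕ) < i := by
  simp only [Spi, mem_image, mem_filter, mem_univ, true_and]
  constructor
  · rintro ⟨m, hm, rfl⟩
    simpa using hm
  · exact fun h => ⟨π.symm j, h, by simp⟩

theorem Spi_zero {k : ℕ} (π : Equiv.Perm (Fin k)) : Spi k π 0 = ∅ := by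
  ext j
  simp [mem_Spi]

theorem Spi_self {k : ℕ} (π : Equiv.Perm (Fin k)) : Spi k π k = univ := by
  ext j
  simp [mem_Spi]

theorem Spi_succ {k : ℕ} (π : Equiv.Perm (Fin k)) (m : Fin k) :
    Spi k π ((m : ℕ) + 1) = insert (π m) (Spi k π m) := by
  ext j
  rw [mem_insert, mem_Spi, mem_Spi, ← Equiv.symm_apply_eq, Fin.ext_iff]
  omega

theorem notMem_Spi {k : ℕ} (π : Equiv.Perm (Fin k)) (m : Fin k) : π m ∉ Spi k π m := by
  simp [mem_Spi]

/-- The marginal gain of `j` when elements are added in the order given by `π`. -/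
def marginal {k : ℕ} (f : Finset (Fin k) → ℝ) (π : Equiv.Perm (Fin k)) (j : Fin k) : ℝ :=
  f (Spi k π ((π.symm j : ℕ) + 1)) - f (Spi k π (π.symm j : ℕ))

theorem sum_fin_sub (k : ℕ) (g : ℕ → ℝ) :
    ∑ m : Fin k, (g ((m : ℕ) + 1) - g m) = g k - g 0 := by
  rw [Fin.sum_univ_eq_sum_range (fun m => g (m + 1) - g m), sum_range_sub]

theorem sum_marginal_univ {k : ℕ} {f : Finset (Fin k) → ℝ} (hnorm : f ∅ = 0)
    (π : Equiv.Perm (Fin k)) : ∑ j, marginal f π j = f univ := by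
  rw [← Equiv.sum_comp π]
  simp only [marginal, Equiv.symm_apply_apply]
  rw [sum_fin_sub k (fun m => f (Spi k π m)), Spi_self, Spi_zero, hnorm, sub_zero]

/-- The marginal gains along an order form a point of the base polytope of `f`. -/
theorem sum_marginal_le {k : ℕ} {f : Finset (Fin k) → ℝ}
    (hsub : ∀ S T : Finset (Fin k), f (S ∪ T) + f (S ∩ T) ≤ f S + f T) (hnorm : f ∅ = 0)
    (π : Equiv.Perm (Fin k)) (S : Finset (Fin k)) : ∑ j ∈ S, marginal f π j ≤ f S := by
  have hS : ∑ j ∈ S, marginal f π j = ∑ j, if j ∈ S then marginal f π j else 0 := by simp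
  have htel := sum_fin_sub k (fun m => f (S ∩ Spi k π m))
  simp only [Spi_self, Spi_zero, inter_univ, inter_empty, hnorm, sub_zero] at htel
  rw [hS, ← Equiv.sum_comp π, ← htel]
  refine sum_le_sum fun m _ => ?_
  split_ifs with hm
  · have h := hsub (S ∩ Spi k π ((m : ℕ) + 1)) (Spi k π m)
    have hunion : S ∩ Spi k π ((m : ℕ) + 1) ∪ Spi k π m = Spi k π ((m : ℕ) + 1) := by
      rw [Spi_succ]
      ext j
      simp only [mem_union, mem_inter, mem_insert]
      grind
    have hinter : S ∩ Spi k π ((m : ℕ) + 1) ∩ Spi k π m = S ∩ Spi k π m := by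
      rw [Spi_succ]
      ext j
      simp only [mem_inter, mem_insert]
      tauto
    rw [hunion, hinter] at h
    simp only [marginal, Equiv.symm_apply_apply]
    linarith
  · rw [Spi_succ, inter_insert_of_notMem hm, sub_self]

/-- Summation by parts against an antitone sequence. -/
theorem mul_le_sum_mul_sub_of_antitone {n : ℕ} {x : Fin n → ℝ} {d : ℕ → ℝ} {c : ℝ}
    (hx : Antitone x) (hd : ∀ m, 0 ≤ d m) (hd0 : d 0 = 0) (hc : ∀ i, c ≤ x i) :
    c * d n ≤ ∑ i : Fin n, x i * (d ((i : ℕ) + 1) - d i) := by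
  induction n generalizing c with
  | zero => simp [hd0]
  | succ n ih =>
    rw [Fin.sum_univ_castSucc]
    have h := ih (x := fun i => x i.castSucc) (c := x (Fin.last n))
      (fun i j hij => hx (by simpa using hij)) (fun i => hx (Fin.le_last _))
    have h' := mul_le_mul_of_nonneg_right (hc (Fin.last n)) (hd (n + 1))
    simp only [Fin.val_castSucc, Fin.val_last] at h ⊢
    linarith

/-- The maximum defining the Lovász extension of a submodular function at `x` is attained by any
permutation sorting `x` decreasingly. -/
theorem lovaszExt_eq_of_antitone {k : ℕ} {f : Finset (Fin k) → ℝ}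
    (hsub : ∀ S T : Finset (Fin k), f (S ∪ T) + f (S ∩ T) ≤ f S + f T) (hnorm : f ∅ = 0)
    {x : Fin k → ℝ} (σ : Equiv.Perm (Fin k)) (hx : Antitone (x ∘ σ)) :
    lovaszExt k f x =
      ∑ i : Fin k, x (σ i) * (f (Spi k σ ((i : ℕ) + 1)) - f (Spi k σ (i : ℕ))) := by
  refine le_antisymm (sup'_le _ _ fun τ _ => ?_) (le_sup' (fun π : Equiv.Perm (Fin k) =>
    ∑ i : Fin k, x (π i) * (f (Spi k π ((i : ℕ) + 1)) - f (Spi k π (i : ℕ)))) (mem_univ σ))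
  have hτ : ∑ i : Fin k, x (τ i) * (f (Spi k τ ((i : ℕ) + 1)) - f (Spi k τ (i : ℕ)))
      = ∑ i : Fin k, x (σ i) * marginal f τ (σ i) := by
    rw [Equiv.sum_comp σ (fun j => x j * marginal f τ j),
      ← Equiv.sum_comp τ (fun j => x j * marginal f τ j)]
    simp only [marginal, Equiv.symm_apply_apply]
  obtain ⟨c, hc⟩ : ∃ c, ∀ i, c ≤ (x ∘ σ) i := by
    obtain ⟨c, hc⟩ := (Set.finite_range (x ∘ σ)).bddBelow
    exact ⟨c, fun i => hc ⟨i, rfl⟩⟩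
  have key := mul_le_sum_mul_sub_of_antitone
    (d := fun m => f (Spi k σ m) - ∑ j ∈ Spi k σ m, marginal f τ j) hx
    (fun m => sub_nonneg.2 (sum_marginal_le hsub hnorm τ _)) (by simp [Spi_zero, hnorm]) hc
  simp only [Spi_self, sum_marginal_univ hnorm, sub_self, mul_zero, Function.comp_apply] at key
  rw [hτ, ← sub_nonneg, ← sum_sub_distrib]
  refine key.trans_eq (sum_congr rfl fun i _ => ?_)
  rw [Spi_succ, sum_insert (notMem_Spi σ i)]
  ring

/-- Points of the simplex `P_{π,y}` have coordinates that, up to the signs `y`, lie in `[0, 1]`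
and decrease along `π`. -/
theorem bounds_of_mem_convexHull_onespi {k : ℕ} {π : Equiv.Perm (Fin k)} {y u : Fin k → ℝ}
    (hy : ∀ i, y i = -1 ∨ y i = 1)
    (hu : u ∈ convexHull ℝ {v : Fin k → ℝ | ∃ i ≤ k, v = fun j => onespi k π i j * y j}) :
    (∀ j, 0 ≤ u j * y j ∧ u j * y j ≤ 1) ∧
      ∀ i j, π.symm i ≤ π.symm j → u j * y j ≤ u i * y i := by
  have hyy : ∀ j, y j * y j = 1 := fun j => by rcases hy j with h | h <;> simp [h]
  revert u
  change convexHull ℝ _ ⊆ {u : Fin k → ℝ | (∀ j, 0 ≤ u j * y j ∧ u j * y j ≤ 1) ∧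
      ∀ i j, π.symm i ≤ π.symm j → u j * y j ≤ u i * y i}
  refine convexHull_min ?_ ?_
  · rintro _ ⟨m, -, rfl⟩
    simp only [Set.mem_ofPred_eq, mul_assoc, hyy, mul_one, onespi, mem_Spi]
    refine ⟨fun j => by split_ifs <;> norm_num, fun i j hij => ?_⟩
    have : (π.symm i : ℕ) ≤ π.symm j := hij
    split_ifs <;> first | omega | norm_num
  · rintro u ⟨hu, hu'⟩ v ⟨hv, hv'⟩ a b ha hb hab
    have hcomb : ∀ j, (a • u + b • v) j * y j = a * (u j * y j) + b * (v j * y j) := fun j => by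
      simp only [Pi.add_apply, Pi.smul_apply, smul_eq_mul]
      ring
    simp only [Set.mem_ofPred_eq, hcomb]
    refine ⟨fun j => ⟨?_, ?_⟩, fun i j hij => ?_⟩
    · exact add_nonneg (mul_nonneg ha (hu j).1) (mul_nonneg hb (hv j).1)
    · have h₁ := mul_le_mul_of_nonneg_left (hu j).2 ha
      have h₂ := mul_le_mul_of_nonneg_left (hv j).2 hb
      linarith
    · exact add_le_add (mul_le_mul_of_nonneg_left (hu' i j hij) ha)
        (mul_le_mul_of_nonneg_left (hv' i j hij) hb)

/-- One permutation sorts `𝟙 - u ⊙ y'` decreasingly for all `u` in the simplex `P_{π,y}`: first the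
coordinates where `y` and `y'` differ, in the order of `π`, then the others in reverse order. -/
theorem exists_perm_antitone {k : ℕ} (π : Equiv.Perm (Fin k)) {y y' : Fin k → ℝ}
    (hy : ∀ i, y i = -1 ∨ y i = 1) (hy' : ∀ i, y' i = -1 ∨ y' i = 1) :
    ∃ σ : Equiv.Perm (Fin k),
      ∀ u ∈ convexHull ℝ {v : Fin k → ℝ | ∃ i ≤ k, v = fun j => onespi k π i j * y j},
        Antitone ((fun j => 1 - u j * y' j) ∘ σ) := by
  classical
  let key : Fin k → ℤ := fun j => if y' j = y j then 2 * k - (π.symm j : ℕ) else (π.symm j : ℕ)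
  refine ⟨Tuple.sort key, fun u hu => ?_⟩
  obtain ⟨hu, hmono⟩ := bounds_of_mem_convexHull_onespi hy hu
  have hneg : ∀ j, y' j ≠ y j → y' j = - y j := fun j h => by
    rcases hy j with h₁ | h₁ <;> rcases hy' j with h₂ | h₂ <;> simp_all
  have hkey : ∀ i j, key i ≤ key j → 1 - u j * y' j ≤ 1 - u i * y' i := by
    intro i j hij
    have hi := (π.symm i).isLt
    have hj := (π.symm j).isLt
    simp only [key] at hij
    split_ifs at hij with h₁ h₂ h₂
    · have := hmono j i (by rw [Fin.le_def]; omega)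
      rw [h₁, h₂]
      linarith
    · omega
    · rw [hneg i h₁, h₂]
      linarith [(hu i).1, (hu j).1]
    · have := hmono i j (by rw [Fin.le_def]; omega)
      rw [hneg i h₁, hneg j h₂]
      linarith
  exact fun i j hij => hkey _ _ (Tuple.monotone_sort key hij)

/-- `u ↦ L^f(u, y')` is affine on each simplex `P_{π,y}`. -/
theorem stmt3 (k : ℕ) (hk : 1 ≤ k) (f : Finset (Fin k) → ℝ)
    (hsub : ∀ S T : Finset (Fin k), f (S ∪ T) + f (S ∩ T) ≤ f S + f T)
    (hinc : ∀ S T : Finset (Fin k), Disjoint S T → f S ≤ f (S ∪ T))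
    (hnorm : f ∅ = 0)
    (π : Equiv.Perm (Fin k)) (y y' : Fin k → ℝ)
    (hy : ∀ i, y i = -1 ∨ y i = 1) (hy' : ∀ i, y' i = -1 ∨ y' i = 1) :
    ∃ (w : Fin k → ℝ) (b : ℝ),
      ∀ u ∈ convexHull ℝ {v : Fin k → ℝ | ∃ i ≤ k, v = fun j => onespi k π i j * y j},
        lovaszHinge k f u y' = (∑ i, w i * u i) + b := by
  obtain ⟨σ, hσ⟩ := exists_perm_antitone π hy hy'
  let D : Fin k → ℝ := marginal f σ
  refine ⟨fun j => -(y' j * D j), ∑ j, D j, fun u hu => ?_⟩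
  have hmax : (fun j => max (1 - u j * y' j) 0) = fun j => 1 - u j * y' j := by
    funext j
    have hb := (bounds_of_mem_convexHull_onespi hy hu).1 j
    refine max_eq_left ?_
    rcases hy j with h₁ | h₁ <;> rcases hy' j with h₂ | h₂ <;> rw [h₁] at hb <;> rw [h₂] <;>
      linarith [hb.1, hb.2]
  rw [lovaszHinge, hmax, lovaszExt_eq_of_antitone hsub hnorm σ (hσ u hu), ← sum_add_distrib,
    ← Equiv.sum_comp σ (fun j => -(y' j * D j) * u j + D j)]
  refine sum_congr rfl fun i _ => ?_
  simp only [D, marginal, Equiv.symm_apply_apply]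
  ring
end
end

section
/- Let f : 2^{[k]} → ℝ be submodular and normalized, and let p̄ be the uniform distribution on Y = {−1,1}^k. Then (a) for every v ∈ V = {−1,0,1}^k, ℓ_abs^f(v; p̄) ≥ f([k]); and (b) for every r ∈ {−1,1}^k, ℓ_abs^f(r; p̄) = 2 f̄, where f̄ = 2^{−k} Σ_{S ⊆ [k]} f(S). -/
open Finset

noncomputable section

/-- The `±1` vector associated with a Boolean vector, indexing the outcome space `Y = {-1,1}^k`. -/
def ytov (k : ℕ) (b : Fin k → Bool) : Fin k → ℝ := fun i => if b i then 1 else -1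

/-- `p` is a probability distribution on `Y = {-1,1}^k`. -/
def IsProb (k : ℕ) (p : (Fin k → ℝ) → ℝ) : Prop :=
  (∀ b : Fin k → Bool, 0 ≤ p (ytov k b)) ∧ ∑ b : Fin k → Bool, p (ytov k b) = 1

/-- The structured abstain loss `ℓ_abs^f`. -/
def labs (k : ℕ) (f : Finset (Fin k) → ℝ) (v y : Fin k → ℝ) : ℝ :=
  f (Finset.univ.filter (fun i => v i * y i < 0)) +
    f (Finset.univ.filter (fun i => v i * y i ≤ 0))

lemma ytov_not (k : ℕ) (b : Fin k → Bool) (i : Fin k) :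
    ytov k (fun j => !b j) i = -ytov k b i := by
  cases hb : b i <;> simp [ytov, hb]

/-- Flipping all outcome signs turns the strict disagreement set into the complement of the weak
one, so submodularity bounds the two values together. -/
lemma univ_le_weak_add_flipped_strict (k : ℕ) (f : Finset (Fin k) → ℝ)
    (hsub : ∀ S T : Finset (Fin k), f (S ∪ T) + f (S ∩ T) ≤ f S + f T)
    (hnorm : f ∅ = 0) (v : Fin k → ℝ) (b : Fin k → Bool) :
    f univ ≤ f (univ.filter (fun i => v i * ytov k (fun j => !b j) i < 0)) +
      f (univ.filter (fun i => v i * ytov k b i ≤ 0)) := by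
  have hcompl : univ.filter (fun i => v i * ytov k (fun j => !b j) i < 0) =
      (univ.filter (fun i => v i * ytov k b i ≤ 0))ᶜ := by
    ext i
    simp [ytov_not]
  have h := hsub (univ.filter (fun i => v i * ytov k b i ≤ 0))ᶜ
    (univ.filter (fun i => v i * ytov k b i ≤ 0))
  rw [← sup_eq_union, ← inf_eq_inter, compl_sup_eq_top, compl_inf_eq_bot, 
    top_eq_univ, bot_eq_empty, hnorm, add_zero] at h
  rwa [hcompl]

lemma sum_not_comp (k : ℕ) (g : (Fin k → Bool) → ℝ) :
    ∑ b : Fin k → Bool, g (fun j => !b j) = ∑ b : Fin k → Bool, g b := by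
  have hinv : Function.Involutive (fun (b : Fin k → Bool) j => !b j) := fun b => by simp
  exact Fintype.sum_bijective _ hinv.bijective _ _ fun _ => rfl

lemma two_pow_mul_le_sum_labs (k : ℕ) (f : Finset (Fin k) → ℝ)
    (hsub : ∀ S T : Finset (Fin k), f (S ∪ T) + f (S ∩ T) ≤ f S + f T)
    (hnorm : f ∅ = 0) (v : Fin k → ℝ) :
    2 ^ k * f univ ≤ ∑ b : Fin k → Bool, labs k f v (ytov k b) := by
  unfold labs
  rw [sum_add_distrib,
    ← sum_not_comp k (fun b => f (univ.filter (fun i => v i * ytov k b i < 0))),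
    ← sum_add_distrib]
  calc 2 ^ k * f univ = ∑ _b : Fin k → Bool, f univ := by simp
    _ ≤ _ := sum_le_sum fun b _ => univ_le_weak_add_flipped_strict k f hsub hnorm v b

lemma bijective_disagreement (k : ℕ) (r : Fin k → ℝ) (hr : ∀ i, r i = -1 ∨ r i = 1) :
    Function.Bijective
      (fun b : Fin k → Bool => univ.filter (fun i => r i * ytov k b i < 0)) := by
  rw [Fintype.bijective_iff_injective_and_card]
  refine ⟨fun b c h => funext fun i => ?_, by simp⟩
  have hi := Finset.ext_iff.mp h i
  simp only [mem_filter, mem_univ, true_and] at hi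
  unfold ytov at hi
  rcases hr i with h1 | h1 <;> rw [h1] at hi <;> cases hb : b i <;> cases hc : c i <;>
    first | rfl | norm_num [hb, hc] at hi

lemma labs_of_sign (k : ℕ) (f : Finset (Fin k) → ℝ) (r : Fin k → ℝ)
    (hr : ∀ i, r i = -1 ∨ r i = 1) (b : Fin k → Bool) :
    labs k f r (ytov k b) = 2 * f (univ.filter (fun i => r i * ytov k b i < 0)) := by
  have hweak : univ.filter (fun i => r i * ytov k b i ≤ 0) =
      univ.filter (fun i => r i * ytov k b i < 0) := by
    ext i
    simp only [mem_filter, mem_univ, true_and]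
    unfold ytov
    rcases hr i with h1 | h1 <;> rw [h1] <;> cases b i <;> norm_num
  rw [labs, hweak, two_mul]

/-- under the uniform distribution, (a) `ℓ_abs^f(v; p̄) ≥ f([k])` for all
`v ∈ {-1,0,1}^k`, and (b) `ℓ_abs^f(r; p̄) = 2 f̄` for all `r ∈ {-1,1}^k`. -/
theorem stmt7 (k : ℕ) (hk : 1 ≤ k) (f : Finset (Fin k) → ℝ)
    (hsub : ∀ S T : Finset (Fin k), f (S ∪ T) + f (S ∩ T) ≤ f S + f T)
    (hnorm : f ∅ = 0) :
    (∀ v : Fin k → ℝ, (∀ i, v i = -1 ∨ v i = 0 ∨ v i = 1) →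
      f Finset.univ ≤ ∑ b : Fin k → Bool, (1 / 2 ^ k : ℝ) * labs k f v (ytov k b)) ∧
    (∀ r : Fin k → ℝ, (∀ i, r i = -1 ∨ r i = 1) →
      ∑ b : Fin k → Bool, (1 / 2 ^ k : ℝ) * labs k f r (ytov k b)
        = 2 * ((1 / 2 ^ k : ℝ) * ∑ S : Finset (Fin k), f S)) := by
  refine ⟨fun v _ => ?_, fun r hr => ?_⟩
  · rw [← mul_sum, one_div, inv_mul_eq_div, le_div_iff₀ (by positivity), mul_comm]
    exact two_pow_mul_le_sum_labs k f hsub hnorm v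
  · rw [← mul_sum, sum_congr rfl fun b _ => labs_of_sign k f r hr b, ← mul_sum,
      Fintype.sum_bijective _ (bijective_disagreement k r hr) _ f fun _ => rfl]
    ring
end
end

section
/- Let f : 2^{[k]} → ℝ be submodular and normalized, and let f̄ = 2^{−k} Σ_{S ⊆ [k]} f(S). Then f̄ ≥ f([k])/2, and moreover f̄ = f([k])/2 if and only if f is modular. -/
open Finset

noncomputable section

section SubmodularAverage

variable {α : Type*} [Fintype α] [DecidableEq α]

/-- Summing a set function over all sets and their complements counts every set twice. -/
theorem sum_add_compl_eq_two_mul (f : Finset α → ℝ) :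
    ∑ S, (f S + f Sᶜ) = 2 * ∑ S, f S := by
  have h : ∑ S : Finset α, f Sᶜ = ∑ S, f S :=
    Function.Bijective.sum_comp (compl_involutive (α := Finset α)).bijective f
  rw [Finset.sum_add_distrib, h, two_mul]

/-- A submodular normalized function satisfies `f univ ≤ f S + f Sᶜ`. -/
theorem univ_le_add_compl_of_submodular {f : Finset α → ℝ}
    (hsub : ∀ S T, f (S ∪ T) + f (S ∩ T) ≤ f S + f T) (hnorm : f ∅ = 0) (S : Finset α) :
    f Finset.univ ≤ f S + f Sᶜ := by
  simpa [hnorm] using hsub S Sᶜ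

/-- A submodular function for which all `f S + f Sᶜ` agree is modular. -/
theorem modular_of_add_compl_eq {f : Finset α → ℝ} {c : ℝ}
    (hsub : ∀ S T, f (S ∪ T) + f (S ∩ T) ≤ f S + f T) (hc : ∀ S, f S + f Sᶜ = c)
    (S T : Finset α) : f (S ∪ T) + f (S ∩ T) = f S + f T := by
  have h := hsub Sᶜ Tᶜ
  rw [← Finset.compl_inter, ← Finset.compl_union] at h
  linarith [hsub S T, hc S, hc T, hc (S ∪ T), hc (S ∩ T)]

end SubmodularAverage

/-- for submodular normalized `f`, `f̄ ≥ f([k])/2`, with equality iff `f`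
is modular, where `f̄ = 2^{-k} Σ_{S ⊆ [k]} f(S)`. -/
theorem stmt8 (k : ℕ) (hk : 1 ≤ k) (f : Finset (Fin k) → ℝ)
    (hsub : ∀ S T : Finset (Fin k), f (S ∪ T) + f (S ∩ T) ≤ f S + f T)
    (hnorm : f ∅ = 0) :
    f Finset.univ / 2 ≤ (1 / 2 ^ k : ℝ) * ∑ S : Finset (Fin k), f S ∧
    ((1 / 2 ^ k : ℝ) * ∑ S : Finset (Fin k), f S = f Finset.univ / 2 ↔
      ∀ S T : Finset (Fin k), f (S ∪ T) + f (S ∩ T) = f S + f T) := by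
  have hpow : (0 : ℝ) < 2 ^ k := by positivity
  have hconst : ∑ _S : Finset (Fin k), f Finset.univ = 2 ^ k * f Finset.univ := by
    simp
  have hle := univ_le_add_compl_of_submodular hsub hnorm
  have hsum := sum_add_compl_eq_two_mul f
  refine ⟨?_, fun h => ?_, fun h => ?_⟩
  · have := Finset.sum_le_sum fun S (_ : S ∈ Finset.univ) => hle S
    rw [hconst, hsum] at this
    rw [one_div_mul_eq_div, le_div_iff₀ hpow]
    linarith
  · rw [one_div_mul_eq_div, div_eq_iff hpow.ne'] at h
    have heq : ∑ _S : Finset (Fin k), f Finset.univ = ∑ S, (f S + f Sᶜ) := by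
      rw [hconst, hsum, h]
      ring
    have hc := (Finset.sum_eq_sum_iff_of_le fun S _ => hle S).1 heq
    exact modular_of_add_compl_eq hsub fun S => (hc S (Finset.mem_univ S)).symm
  · have hc (S : Finset (Fin k)) : f S + f Sᶜ = f Finset.univ := by
      simpa [hnorm] using (h S Sᶜ).symm
    simp only [hc, hconst] at hsum
    rw [one_div_mul_eq_div, div_eq_iff hpow.ne']
    linarith
end
end

section
/- Let L : ℝ^k → ℝ be a convex function that is affine on a nonempty convex set C ⊆ ℝ^k. Then for every x in the relative interior of C and every z ∈ C, the subdifferential of L at x is contained in the subdifferential of L at z; that is, every w ∈ ℝ^k satisfying L(v) ≥ L(x) + ⟨w, v − x⟩ for all v ∈ ℝ^k also satisfies L(v) ≥ L(z) + ⟨w, v − z⟩ for all v ∈ ℝ^k. -/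
open Finset

noncomputable section

/-- A segment from a point of `s` to a point of the intrinsic interior of `s` can be prolonged
inside `s`. -/
theorem exists_pos_lineMap_neg_mem_of_mem_intrinsicInterior {E : Type*} [AddCommGroup E]
    [Module ℝ E] [TopologicalSpace E] [IsTopologicalAddGroup E] [ContinuousSMul ℝ E]
    {s : Set E} {x z : E} (hx : x ∈ intrinsicInterior ℝ s) (hz : z ∈ affineSpan ℝ s) :
    ∃ t : ℝ, 0 < t ∧ AffineMap.lineMap x z (-t) ∈ s := by
  obtain ⟨y, hy, rfl⟩ := mem_intrinsicInterior.1 hx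
  let f : ℝ → affineSpan ℝ s := fun t =>
    ⟨AffineMap.lineMap (y : E) z (-t), AffineMap.lineMap_mem _ y.2 hz⟩
  have hf : Continuous f := by
    refine Continuous.subtype_mk ?_ _
    simp only [AffineMap.lineMap_apply_module]
    fun_prop
  have hf0 : f 0 = y := Subtype.ext (by simp [f])
  have hev : ∀ᶠ t in nhds (0 : ℝ), f t ∈ interior ((↑) ⁻¹' s : Set (affineSpan ℝ s)) :=
    hf.continuousAt.eventually_mem (isOpen_interior.mem_nhds (hf0 ▸ hy))
  obtain ⟨t, ht, ht0⟩ :=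
    ((hev.filter_mono nhdsWithin_le_nhds).and (self_mem_nhdsWithin (s := Set.Ioi (0 : ℝ)))).exists
  exact ⟨t, ht0, (interior_subset ht : f t ∈ _)⟩

/-- if a convex `L` is affine on a convex set `C`, then for `x` in the
relative interior of `C` and any `z ∈ C`, `∂L(x) ⊆ ∂L(z)`. -/
theorem stmt11 (k : ℕ) (L : (Fin k → ℝ) → ℝ) (hconv : ConvexOn ℝ Set.univ L)
    (C : Set (Fin k → ℝ)) (hC : Convex ℝ C) (hne : C.Nonempty)
    (haff : ∃ (w' : Fin k → ℝ) (b : ℝ), ∀ z ∈ C, L z = (∑ i, w' i * z i) + b)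
    (x : Fin k → ℝ) (hx : x ∈ intrinsicInterior ℝ C)
    (z : Fin k → ℝ) (hz : z ∈ C)
    (w : Fin k → ℝ) (hw : ∀ v : Fin k → ℝ, L x + ∑ i, w i * (v i - x i) ≤ L v) :
    ∀ v : Fin k → ℝ, L z + ∑ i, w i * (v i - z i) ≤ L v := by
  intro v
  obtain ⟨w', b, hL⟩ := haff
  obtain ⟨t, ht, hy⟩ :=
    exists_pos_lineMap_neg_mem_of_mem_intrinsicInterior hx (subset_affineSpan ℝ C hz)
  have hwy := hw (AffineMap.lineMap x z (-t))
  have hwv := hw v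
  have hLx := hL x (intrinsicInterior_subset hx)
  have hLz := hL z hz
  have hsum (u : Fin k → ℝ) :
      ∑ i, u i * AffineMap.lineMap x z (-t) i =
        ∑ i, u i * x i + t * (∑ i, u i * x i - ∑ i, u i * z i) := by
    rw [← sum_sub_distrib, mul_sum, ← sum_add_distrib]
    refine sum_congr rfl fun i _ => ?_
    simp only [AffineMap.lineMap_apply_module, Pi.add_apply, Pi.smul_apply, smul_eq_mul]
    ring
  rw [hL _ hy, hsum w'] at hwy
  simp only [mul_sub, sum_sub_distrib] at hwy hwv ⊢
  rw [hsum w] at hwy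
  have hxz : ∑ i, w i * x i - ∑ i, w i * z i ≤ L x - L z := by
    refine le_of_mul_le_mul_left ?_ ht
    rw [hLx, hLz]
    linarith
  linarith
end
end

section
/- Let f : 2^{[k]} → ℝ be submodular, increasing, and normalized, let p be a probability distribution on Y = {−1,1}^k, and let U = Γ_{L^f}(p) = {u* ∈ ℝ^k : L^f(u*; p) ≤ L^f(u'; p) for all u' ∈ ℝ^k}. Then for every u ∈ ℝ^k and every 0 < ε < 2: if there exists u' ∈ U with ‖u' − u‖_∞ < ε, then there exists u'' ∈ U ∩ [−1,1]^k with ‖u'' − ⌊u⌉‖_∞ < ε. -/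
open Finset

noncomputable section

/-- Expected Lovász hinge loss `L^f(u; p)`. -/
def expLossL (k : ℕ) (f : Finset (Fin k) → ℝ) (u : Fin k → ℝ) (p : (Fin k → ℝ) → ℝ) : ℝ :=
  ∑ b : Fin k → Bool, p (ytov k b) * lovaszHinge k f u (ytov k b)

/-- The property elicited by the Lovász hinge: minimizers of `L^f(·; p)` over `ℝ^k`. -/
def GammaL (k : ℕ) (f : Finset (Fin k) → ℝ) (p : (Fin k → ℝ) → ℝ) : Set (Fin k → ℝ) :=
  {u | ∀ u' : Fin k → ℝ, expLossL k f u p ≤ expLossL k f u' p}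

theorem Spi_subset_succ (k : ℕ) (π : Equiv.Perm (Fin k)) (i : ℕ) :
    Spi k π i ⊆ Spi k π (i + 1) := by
  unfold Spi
  gcongr
  omega

theorem lovaszExt_mono_s13 (k : ℕ) (f : Finset (Fin k) → ℝ)
    (hinc : ∀ S T : Finset (Fin k), Disjoint S T → f S ≤ f (S ∪ T))
    {x x' : Fin k → ℝ} (h : x ≤ x') : lovaszExt k f x ≤ lovaszExt k f x' := by
  refine Finset.sup'_mono_fun fun π _ => Finset.sum_le_sum fun i _ =>
    mul_le_mul_of_nonneg_right (h (π i)) (sub_nonneg.2 ?_)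
  have hf := hinc (Spi k π i) (Spi k π (i + 1) \ Spi k π i) Finset.disjoint_sdiff
  rwa [Finset.union_sdiff_of_subset (Spi_subset_succ k π i)] at hf

theorem clip_apply {k : ℕ} (u : Fin k → ℝ) (i : Fin k) :
    clip u i = max (-1) (min 1 (u i)) := by
  unfold clip
  rcases lt_trichotomy (u i) 0 with h | h | h
  · rw [Real.sign_of_neg h, abs_of_neg h]
    grind
  · simp [h]
  · rw [Real.sign_of_pos h, abs_of_pos h]
    grind

theorem abs_clip_le_one {k : ℕ} (u : Fin k → ℝ) (i : Fin k) : |clip u i| ≤ 1 := by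
  rw [clip_apply]
  grind

theorem norm_clip_sub_clip_le {k : ℕ} (u v : Fin k → ℝ) : ‖clip u - clip v‖ ≤ ‖u - v‖ := by
  refine (pi_norm_le_iff_of_nonneg (norm_nonneg _)).2 fun i => le_trans ?_ (norm_le_pi_norm _ i)
  simp only [Pi.sub_apply, Real.norm_eq_abs, clip_apply]
  grind

theorem lovaszHinge_clip_le (k : ℕ) (f : Finset (Fin k) → ℝ)
    (hinc : ∀ S T : Finset (Fin k), Disjoint S T → f S ≤ f (S ∪ T))
    (u : Fin k → ℝ) (b : Fin k → Bool) :
    lovaszHinge k f (clip u) (ytov k b) ≤ lovaszHinge k f u (ytov k b) := by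
  refine lovaszExt_mono_s13 k f hinc fun i => ?_
  simp only [clip_apply, ytov]
  split_ifs <;> grind

theorem clip_mem_GammaL (k : ℕ) (f : Finset (Fin k) → ℝ)
    (hinc : ∀ S T : Finset (Fin k), Disjoint S T → f S ≤ f (S ∪ T))
    (p : (Fin k → ℝ) → ℝ) (hp : ∀ b : Fin k → Bool, 0 ≤ p (ytov k b))
    {u : Fin k → ℝ} (hu : u ∈ GammaL k f p) : clip u ∈ GammaL k f p := fun v =>
  (Finset.sum_le_sum fun b _ =>
    mul_le_mul_of_nonneg_left (lovaszHinge_clip_le k f hinc u b) (hp b)).trans (hu v)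

/-- if some optimal point is within sup-distance `ε` of `u`, then some optimal
point inside `[-1,1]^k` is within sup-distance `ε` of the clipped point `⌊u⌉`. -/
theorem stmt13 (k : ℕ) (hk : 1 ≤ k) (f : Finset (Fin k) → ℝ)
    (hsub : ∀ S T : Finset (Fin k), f (S ∪ T) + f (S ∩ T) ≤ f S + f T)
    (hinc : ∀ S T : Finset (Fin k), Disjoint S T → f S ≤ f (S ∪ T))
    (hnorm : f ∅ = 0)
    (p : (Fin k → ℝ) → ℝ) (hp : IsProb k p)
    (ε : ℝ) (hε : 0 < ε) (hε2 : ε < 2) (u : Fin k → ℝ)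
    (h : ∃ u' ∈ GammaL k f p, ‖u' - u‖ < ε) :
    ∃ u'' : Fin k → ℝ, u'' ∈ GammaL k f p ∧ (∀ i, |u'' i| ≤ 1) ∧ ‖u'' - clip u‖ < ε := by
  obtain ⟨u', hu', hlt⟩ := h
  exact ⟨clip u', clip_mem_GammaL k f hinc p hp.1 hu', abs_clip_le_one u',
    (norm_clip_sub_clip_le u' u).trans_lt hlt⟩
end
end

section
/- Fix ε > 0. For every u ∈ ℝ^k, every y ∈ {−1,1}^k, and every permutation π of [k], the link envelope satisfies Ψ̂(π(u ⊙ y)) = π(Ψ̂(u) ⊙ y), where (πx)_i = x_{π(i)} for x ∈ ℝ^k and both operations are applied elementwise to sets. -/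
open Finset

noncomputable section

/-- `V^face`: all subsets of some `V_{π,y}`. -/
def Vface (k : ℕ) : Set (Set (Fin k → ℝ)) :=
  {V' | ∃ (π : Equiv.Perm (Fin k)) (y : Fin k → ℝ), (∀ i, y i = -1 ∨ y i = 1) ∧
      V' ⊆ {v | ∃ i ≤ k, v = fun j => onespi k π i j * y j}}

/-- The link envelope `Ψ̂(u)`: the intersection of all `V' ∈ V^face` whose convex hull is
within sup-distance `ε` of the clipped point `⌊u⌉`. -/
def psiHat (k : ℕ) (ε : ℝ) (u : Fin k → ℝ) : Set (Fin k → ℝ) :=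
  ⋂₀ {V' | V' ∈ Vface k ∧ ∃ a ∈ convexHull ℝ V', ‖a - clip u‖ < ε}

/-- The signed permutation `v ↦ π(v ⊙ y)` as a linear map. -/
def signedPerm {k : ℕ} (π : Equiv.Perm (Fin k)) (y : Fin k → ℝ) :
    (Fin k → ℝ) →ₗ[ℝ] (Fin k → ℝ) where
  toFun v i := v (π i) * y (π i)
  map_add' v w := by ext i; simp [add_mul]
  map_smul' c v := by ext i; simp [mul_assoc]

section SignedPerm

variable {k : ℕ}

lemma signedPerm_apply (π : Equiv.Perm (Fin k)) (y v : Fin k → ℝ) (i : Fin k) :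
    signedPerm π y v i = v (π i) * y (π i) := rfl

lemma mul_self_of_eq_neg_one_or_one {y : Fin k → ℝ} (hy : ∀ i, y i = -1 ∨ y i = 1) (i : Fin k) :
    y i * y i = 1 := by
  rcases hy i with h | h <;> simp [h]

lemma signedPerm_inv_signedPerm (π : Equiv.Perm (Fin k)) {y : Fin k → ℝ}
    (hy : ∀ i, y i = -1 ∨ y i = 1) (v : Fin k → ℝ) :
    signedPerm π⁻¹ (fun i => y (π i)) (signedPerm π y v) = v := by
  ext i
  simp [signedPerm_apply, mul_assoc, mul_self_of_eq_neg_one_or_one hy]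

lemma signedPerm_signedPerm_inv (π : Equiv.Perm (Fin k)) {y : Fin k → ℝ}
    (hy : ∀ i, y i = -1 ∨ y i = 1) (v : Fin k → ℝ) :
    signedPerm π y (signedPerm π⁻¹ (fun i => y (π i)) v) = v := by
  ext i
  simp [signedPerm_apply, mul_assoc, mul_self_of_eq_neg_one_or_one hy]

lemma norm_signedPerm_le (π : Equiv.Perm (Fin k)) {y : Fin k → ℝ}
    (hy : ∀ i, y i = -1 ∨ y i = 1) (v : Fin k → ℝ) : ‖signedPerm π y v‖ ≤ ‖v‖ := by
  refine (pi_norm_le_iff_of_nonneg (norm_nonneg v)).2 fun i => ?_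
  have h : ‖signedPerm π y v i‖ = ‖v (π i)‖ := by
    rcases hy (π i) with h | h <;> simp [signedPerm_apply, h]
  exact h.le.trans (norm_le_pi_norm v (π i))

lemma clip_signedPerm (π : Equiv.Perm (Fin k)) {y : Fin k → ℝ}
    (hy : ∀ i, y i = -1 ∨ y i = 1) (u : Fin k → ℝ) :
    clip (signedPerm π y u) = signedPerm π y (clip u) := by
  ext i
  rcases hy (π i) with h | h <;> simp [clip, signedPerm_apply, h, Real.sign_neg]

lemma onespi_inv_mul (π σ : Equiv.Perm (Fin k)) (i : ℕ) (j : Fin k) :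
    onespi k (π⁻¹ * σ) i j = onespi k σ i (π j) := by
  have h : j ∈ Spi k (π⁻¹ * σ) i ↔ π j ∈ Spi k σ i := by
    simp [Spi, Equiv.symm_apply_eq]
  simp only [onespi, h]

lemma image_signedPerm_mem_Vface (π : Equiv.Perm (Fin k)) {y : Fin k → ℝ}
    (hy : ∀ i, y i = -1 ∨ y i = 1) {V : Set (Fin k → ℝ)} (hV : V ∈ Vface k) :
    signedPerm π y '' V ∈ Vface k := by
  obtain ⟨σ, z, hz, hVσ⟩ := hV
  refine ⟨π⁻¹ * σ, signedPerm π y z, fun i => ?_, ?_⟩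
  · rcases hy (π i) with h | h <;> rcases hz (π i) with h' | h' <;>
      simp [signedPerm_apply, h, h']
  · rintro _ ⟨v, hv, rfl⟩
    obtain ⟨i, hi, rfl⟩ := hVσ hv
    refine ⟨i, hi, ?_⟩
    ext j
    simp only [signedPerm_apply, onespi_inv_mul, mul_assoc]

lemma exists_mem_convexHull_image_signedPerm (π : Equiv.Perm (Fin k)) {y : Fin k → ℝ}
    (hy : ∀ i, y i = -1 ∨ y i = 1) {V : Set (Fin k → ℝ)} {ε : ℝ} {u : Fin k → ℝ}
    (hV : ∃ a ∈ convexHull ℝ V, ‖a - clip u‖ < ε) :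
    ∃ a ∈ convexHull ℝ (signedPerm π y '' V), ‖a - clip (signedPerm π y u)‖ < ε := by
  obtain ⟨a, ha, hau⟩ := hV
  refine ⟨signedPerm π y a, ?_, ?_⟩
  · rw [← LinearMap.image_convexHull]
    exact Set.mem_image_of_mem _ ha
  · rw [clip_signedPerm π hy, ← map_sub]
    exact (norm_signedPerm_le π hy _).trans_lt hau

lemma signedPerm_mem_psiHat (π : Equiv.Perm (Fin k)) {y : Fin k → ℝ}
    (hy : ∀ i, y i = -1 ∨ y i = 1) {ε : ℝ} {u v : Fin k → ℝ} (hv : v ∈ psiHat k ε u) :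
    signedPerm π y v ∈ psiHat k ε (signedPerm π y u) := by
  rintro V ⟨hV, hVu⟩
  have hy' : ∀ i, y (π i) = -1 ∨ y (π i) = 1 := fun i => hy (π i)
  have hu := exists_mem_convexHull_image_signedPerm π⁻¹ hy' hVu
  rw [signedPerm_inv_signedPerm π hy] at hu
  obtain ⟨w, hw, rfl⟩ := hv _ ⟨image_signedPerm_mem_Vface π⁻¹ hy' hV, hu⟩
  rwa [signedPerm_signedPerm_inv π hy]

end SignedPerm

/-- the link envelope is symmetric under signed permutations:
`Ψ̂(π(u ⊙ y)) = π(Ψ̂(u) ⊙ y)`. -/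
theorem stmt15 (k : ℕ) (hk : 1 ≤ k) (ε : ℝ) (hε : 0 < ε)
    (u y : Fin k → ℝ) (hy : ∀ i, y i = -1 ∨ y i = 1) (π : Equiv.Perm (Fin k)) :
    psiHat k ε (fun i => u (π i) * y (π i)) =
      (fun v : Fin k → ℝ => fun i => v (π i) * y (π i)) '' psiHat k ε u := by
  change psiHat k ε (signedPerm π y u) = signedPerm π y '' psiHat k ε u
  refine Set.Subset.antisymm (fun w hw => ?_) ?_
  · refine ⟨signedPerm π⁻¹ (fun i => y (π i)) w, ?_, signedPerm_signedPerm_inv π hy w⟩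
    simpa only [signedPerm_inv_signedPerm π hy] using
      signedPerm_mem_psiHat π⁻¹ (fun i => hy (π i)) hw
  · rintro _ ⟨v, hv, rfl⟩
    exact signedPerm_mem_psiHat π hy hv
end
end
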